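/- Let x be a separated vector in the James Tree space JT such that its range ran(x) is a well-founded subtree of T, i.e. ran(x) contains no infinite branch. Then x is an extreme point of the ball of radius ‖x‖_{JT}. -/

import Mathlib

/-! Common framework for the James Tree space `JT`.

The dyadic tree is modelled as `List Bool`, ordered by `List.IsPrefix` (`<+:`). -/

abbrev DyadicNode := List Bool

namespace JTSpace

/-- A segment of the dyadic tree: a linearly ordered, order-convex subset. -/
def IsSegment (S : Set DyadicNode) : Prop :=
  (∀ a ∈ S, ∀ b ∈ S, a <+: b ∨ b <+: a) ∧
  (∀ a ∈ S, ∀ b ∈ S, ∀ c : DyadicNode, a <+: c → c <+: b → c ∈ S)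

/-- A partition: a family of pairwise disjoint segments. -/
def IsPartition (P : Set (Set DyadicNode)) : Prop :=
  (∀ S ∈ P, IsSegment S) ∧ P.PairwiseDisjoint id

/-- The sum of `x` along a set of nodes. -/
noncomputable def segSum (x : DyadicNode → ℝ) (S : Set DyadicNode) : ℝ :=
  ∑' a : S, x a

/-- The square of the value `‖x‖_P` of `x` on the partition `P`. -/
noncomputable def pNormSq (x : DyadicNode → ℝ) (P : Set (Set DyadicNode)) : ℝ :=
  ∑' S : P, (segSum x S) ^ 2

/-- The set of all values `‖x‖_P²` over partitions `P`. -/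
def normSqSet (x : DyadicNode → ℝ) : Set ℝ :=
  {r | ∃ P, IsPartition P ∧ r = pNormSq x P}

/-- The square of the `JT` norm. -/
noncomputable def JTnormSq (x : DyadicNode → ℝ) : ℝ := sSup (normSqSet x)

/-- The `JT` norm of `x`. -/
noncomputable def JTnorm (x : DyadicNode → ℝ) : ℝ := Real.sqrt (JTnormSq x)

/-- The `ℓ₂` norm of `x`. -/
noncomputable def l2norm (x : DyadicNode → ℝ) : ℝ := Real.sqrt (∑' a, (x a) ^ 2)

def HasBddNorm (x : DyadicNode → ℝ) : Prop := BddAbove (normSqSet x)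

/-- `x` belongs to the James Tree space: its norm is finite and it is approximable in the
`JT` norm by finitely supported functions (`JT` is the completion of `c₀₀(T)`). -/
def MemJT (x : DyadicNode → ℝ) : Prop :=
  HasBddNorm x ∧
  ∀ ε > (0 : ℝ), ∃ y : DyadicNode → ℝ, (Function.support y).Finite ∧
    HasBddNorm (x - y) ∧ JTnorm (x - y) ≤ ε

/-- An `x`-norming partition. -/
def IsNormingPartition (x : DyadicNode → ℝ) (P : Set (Set DyadicNode)) : Prop :=
  IsPartition P ∧ pNormSq x P = JTnormSq x

/-- A complete subtree of the dyadic tree. -/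
def IsCompleteSubtree (K : Set DyadicNode) : Prop :=
  ∀ a ∈ K, ∀ b ∈ K, ∀ c : DyadicNode, a <+: c → c <+: b → c ∈ K

/-- The range of `x`: the smallest complete subtree containing the support of `x`. -/
def ran (x : DyadicNode → ℝ) : Set DyadicNode :=
  ⋂₀ {K | IsCompleteSubtree K ∧ Function.support x ⊆ K}

/-- `x` is separated: every two distinct nodes of `ran x` are separated by some
`x`-norming partition. -/
def Separated (x : DyadicNode → ℝ) : Prop :=
  ∀ a ∈ ran x, ∀ b ∈ ran x, a ≠ b →
    ∃ P, IsNormingPartition x P ∧ ∃ S ∈ P, ∃ S' ∈ P, S ≠ S' ∧ a ∈ S ∧ b ∈ S'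

/-- `x` is an extreme point of the ball of radius `‖x‖_{JT}`. -/
def IsExtremePoint (x : DyadicNode → ℝ) : Prop :=
  x ≠ 0 ∧
  ∀ y z : DyadicNode → ℝ, MemJT y → MemJT z →
    ∀ l : ℝ, 0 < l → l < 1 → x = l • y + (1 - l) • z →
      JTnorm y = JTnorm x → JTnorm z = JTnorm x → y = x ∧ z = x

/-- A branch: a maximal segment. -/
def IsBranch (b : Set DyadicNode) : Prop :=
  IsSegment b ∧ ∀ S : Set DyadicNode, IsSegment S → b ⊆ S → S = b

/-- The wedge rooted at `a`. -/
def wedge (a : DyadicNode) : Set DyadicNode := {b | a <+: b}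

/-- The two children of a node. -/
def children (u : DyadicNode) : Set DyadicNode := {u ++ [false], u ++ [true]}

/-- The maximal segment sum starting at `a`:
`S_a(x) = sup { S_s(x) : s a segment with min s = a }`. -/
noncomputable def maxSum (x : DyadicNode → ℝ) (a : DyadicNode) : ℝ :=
  sSup {r | ∃ s : Set DyadicNode, IsSegment s ∧ a ∈ s ∧ (∀ b ∈ s, a <+: b) ∧ r = segSum x s}

/-- The children of `u` within the subtree spanned by the support of `x`. -/
def supportedChildren (x : DyadicNode → ℝ) (u : DyadicNode) : Set DyadicNode :=
  {c ∈ children u | ∃ b ∈ Function.support x, c <+: b}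

/-- A greedy partition for a positive vector `x`: a partition whose segments cover the
support of `x` and such that every segment, at every support node `u` which has a strict
descendant in the support, continues through a child of `u` (within the subtree spanned by
the support) maximizing the maximal segment sum, down to the next element of the support;
at support nodes with no strict descendant in the support, the segment's support ends. -/
def IsGreedyPartition (x : DyadicNode → ℝ) (P : Set (Set DyadicNode)) : Prop :=
  IsPartition P ∧ Function.support x ⊆ ⋃₀ P ∧
  ∀ s ∈ P, ∀ u ∈ s ∩ Function.support x,
    ((∃ w ∈ Function.support x, u <+: w ∧ u ≠ w) →
      ∃ v ∈ s ∩ Function.support x, u <+: v ∧ u ≠ v ∧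
        (∀ w ∈ s ∩ Function.support x, u <+: w → u ≠ w → v <+: w) ∧
        ∃ c ∈ supportedChildren x u, c <+: v ∧
          ∀ k ∈ supportedChildren x u, maxSum x k ≤ maxSum x c) ∧
    ((¬ ∃ w ∈ Function.support x, u <+: w ∧ u ≠ w) →
      ∀ w ∈ s ∩ Function.support x, w <+: u)


lemma ran_complete (x : DyadicNode → ℝ) : IsCompleteSubtree (ran x) := by
  intro a ha b hb c hac hcb K hK
  exact hK.1 a (ha K hK) b (hb K hK) c hac hcb

lemma support_subset_ran (x : DyadicNode → ℝ) : Function.support x ⊆ ran x :=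
  fun _ ha _ hK => hK.2 ha

lemma segSum_inter_ran (x : DyadicNode → ℝ) (S : Set DyadicNode) :
    segSum x (S ∩ ran x) = segSum x S := by
  unfold segSum
  rw [tsum_subtype, tsum_subtype]
  congr 1
  funext a
  by_cases haS : a ∈ S
  · by_cases haR : a ∈ ran x
    · simp [Set.indicator, haS, haR]
    · have : x a = 0 := by
        by_contra h
        exact haR (support_subset_ran x h)
      simp [Set.indicator, haS, this]
  · simp [Set.indicator, haS]

lemma JTnormSq_nonneg (x : DyadicNode → ℝ) : 0 ≤ JTnormSq x := by
  apply Real.sSup_nonneg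
  rintro r ⟨P, -, rfl⟩
  exact tsum_nonneg (fun _ => sq_nonneg _)

lemma finite_family_le {v : DyadicNode → ℝ} (hv : HasBddNorm v) {ι : Type*}
    (A : ι → Set DyadicNode) (hA : ∀ i, IsSegment (A i))
    (hd : ∀ i j, i ≠ j → Disjoint (A i) (A j)) (s : Finset ι) :
    ∑ i ∈ s, (segSum v (A i)) ^ 2 ≤ JTnormSq v := by
  classical
  set t := s.filter (fun i => (A i).Nonempty) with ht
  have h1 : ∑ i ∈ s, (segSum v (A i)) ^ 2 = ∑ i ∈ t, (segSum v (A i)) ^ 2 := by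
    rw [ht, Finset.sum_filter]
    apply Finset.sum_congr rfl
    intro i _
    split_ifs with h
    · rfl
    · rw [Set.not_nonempty_iff_eq_empty] at h
      simp [segSum, h]
  have hinj : Set.InjOn A t := by
    intro i hi j hj hij
    by_contra hne
    have := hd i j hne
    rw [← hij, disjoint_self] at this
    have hne' : (A i).Nonempty := (Finset.mem_filter.1 hi).2
    rw [this] at hne'
    simp at hne'
  have h2 : ∑ i ∈ t, (segSum v (A i)) ^ 2 = pNormSq v (↑(t.image A) : Set (Set DyadicNode)) := by
    unfold pNormSq
    rw [Finset.tsum_subtype' (t.image A) (fun S => (segSum v S) ^ 2), Finset.sum_image hinj]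
  rw [h1, h2]
  apply le_csSup hv
  refine ⟨_, ⟨?_, ?_⟩, rfl⟩
  · intro S hS
    obtain ⟨i, -, rfl⟩ := Finset.mem_image.1 (Finset.mem_coe.1 hS)
    exact hA i
  · intro S hS S' hS' hne
    obtain ⟨i, -, rfl⟩ := Finset.mem_image.1 (Finset.mem_coe.1 hS)
    obtain ⟨j, -, rfl⟩ := Finset.mem_image.1 (Finset.mem_coe.1 hS')
    exact hd i j (fun h => hne (by rw [h]))

lemma family_summable {v : DyadicNode → ℝ} (hv : HasBddNorm v) {ι : Type*}
    (A : ι → Set DyadicNode) (hA : ∀ i, IsSegment (A i))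
    (hd : ∀ i j, i ≠ j → Disjoint (A i) (A j)) :
    Summable (fun i => (segSum v (A i)) ^ 2) :=
  summable_of_sum_le (fun _ => sq_nonneg _) (finite_family_le hv A hA hd)

lemma family_le {v : DyadicNode → ℝ} (hv : HasBddNorm v) {ι : Type*}
    (A : ι → Set DyadicNode) (hA : ∀ i, IsSegment (A i))
    (hd : ∀ i j, i ≠ j → Disjoint (A i) (A j)) :
    ∑' i, (segSum v (A i)) ^ 2 ≤ JTnormSq v :=
  (family_summable hv A hA hd).tsum_le_of_sum_le (finite_family_le hv A hA hd)

lemma core {x y z : DyadicNode → ℝ} (hy : HasBddNorm y) (hz : HasBddNorm z)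
    {l : ℝ} (hl0 : 0 < l) (hl1 : l < 1) (hxyz : x = l • y + (1 - l) • z)
    (hyx : JTnormSq y = JTnormSq x) (hzx : JTnormSq z = JTnormSq x) {ι : Type*}
    (A : ι → Set DyadicNode) (hA : ∀ i, IsSegment (A i)) (hf : ∀ i, (A i).Finite)
    (hd : ∀ i j, i ≠ j → Disjoint (A i) (A j))
    (hN : JTnormSq x ≤ ∑' i, (segSum x (A i)) ^ 2) (i : ι) :
    segSum y (A i) = segSum x (A i) := by
  have hlin : ∀ i, segSum x (A i) = l * segSum y (A i) + (1 - l) * segSum z (A i) := by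
    intro i
    haveI := (hf i).fintype
    simp only [segSum, tsum_fintype]
    rw [Finset.mul_sum, Finset.mul_sum, ← Finset.sum_add_distrib, hxyz]
    simp
  have sy := family_summable hy A hA hd
  have sz := family_summable hz A hA hd
  have ly := family_le hy A hA hd
  have lz := family_le hz A hA hd
  have hsq : ∀ i, l * (1 - l) * (segSum y (A i) - segSum z (A i)) ^ 2 ≤
      2 * l * (1 - l) * (segSum y (A i)) ^ 2 + 2 * l * (1 - l) * (segSum z (A i)) ^ 2 := by
    intro i
    have : 0 ≤ l * (1 - l) := mul_nonneg hl0.le (by linarith)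
    nlinarith [mul_nonneg this (sq_nonneg (segSum y (A i) + segSum z (A i)))]
  have hpos : 0 < l * (1 - l) := mul_pos hl0 (by linarith)
  have sd : Summable (fun i => l * (1 - l) * (segSum y (A i) - segSum z (A i)) ^ 2) :=
    Summable.of_nonneg_of_le (fun i => mul_nonneg hpos.le (sq_nonneg _)) hsq
      ((sy.mul_left _).add (sz.mul_left _))
  have heq : ∑' i, (segSum x (A i)) ^ 2 = l * ∑' i, (segSum y (A i)) ^ 2 +
      (1 - l) * ∑' i, (segSum z (A i)) ^ 2 -
      ∑' i, l * (1 - l) * (segSum y (A i) - segSum z (A i)) ^ 2 := by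
    rw [← tsum_mul_left, ← tsum_mul_left, ← (sy.mul_left l).tsum_add (sz.mul_left (1 - l)),
      ← ((sy.mul_left l).add (sz.mul_left (1 - l))).tsum_sub sd]
    congr 1
    funext i
    rw [hlin i]
    ring
  have hle := sd.le_tsum i (fun j _ => mul_nonneg hpos.le (sq_nonneg _))
  have h3 : l * (1 - l) * (segSum y (A i) - segSum z (A i)) ^ 2 ≤ 0 := by
    have e1 := mul_le_mul_of_nonneg_left ly hl0.le
    have e2 := mul_le_mul_of_nonneg_left lz (by linarith : 0 ≤ 1 - l)
    rw [hyx] at e1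
    rw [hzx] at e2
    linarith
  have h4 : (segSum y (A i) - segSum z (A i)) ^ 2 ≤ 0 := by
    by_contra h
    push Not at h
    linarith [mul_pos hpos h]
  have h5 : segSum y (A i) - segSum z (A i) = 0 := by
    nlinarith [sq_nonneg (segSum y (A i) - segSum z (A i)),
      pow_eq_zero_iff (two_ne_zero) |>.1 (le_antisymm h4 (sq_nonneg _))]
  rw [hlin i]
  linear_combination (1 - l) * h5

lemma chain_finite {R C : Set DyadicNode}
    (hwf : ∀ f : ℕ → DyadicNode, (∀ n, f n ∈ R) →
      (∀ n, f n <+: f (n + 1) ∧ f n ≠ f (n + 1)) → False)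
    (hCR : C ⊆ R) (hC : ∀ a ∈ C, ∀ b ∈ C, a <+: b ∨ b <+: a) : C.Finite := by
  by_contra hinf
  have step : ∀ a : C, ∃ b : C, a.1 <+: b.1 ∧ a.1 ≠ b.1 := by
    rintro ⟨a, ha⟩
    by_contra hcon
    push Not at hcon
    apply hinf
    apply (List.finite_length_le Bool a.length).subset
    intro b hb
    rcases hC a ha b hb with h | h
    · have := hcon ⟨b, hb⟩ h
      simp at this
      simp [this]
    · exact h.length_le
  have hne : C.Nonempty := by
    rw [Set.nonempty_iff_ne_empty]
    rintro rfl
    exact hinf Set.finite_empty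
  obtain ⟨a, ha⟩ := hne
  choose g hg using step
  refine hwf (fun n => (g^[n] ⟨a, ha⟩).1) (fun n => hCR (g^[n] ⟨a, ha⟩).2) (fun n => ?_)
  simp only [Function.iterate_succ_apply']
  exact hg _

lemma exists_norming {x : DyadicNode → ℝ} (hx0 : x ≠ 0)
    (hsep : Separated x) : ∃ P, IsNormingPartition x P := by
  obtain ⟨a, ha⟩ : ∃ a, x a ≠ 0 := by
    by_contra h
    push Not at h
    exact hx0 (funext h)
  by_cases hb : ∃ b, x b ≠ 0 ∧ a ≠ b
  · obtain ⟨b, hb, hab⟩ := hb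
    obtain ⟨P, hP, -⟩ := hsep a (support_subset_ran x ha) b (support_subset_ran x hb) hab
    exact ⟨P, hP⟩
  have hz : ∀ b, a ≠ b → x b = 0 := by
    intro b hab
    by_contra h
    exact hb ⟨b, h, hab⟩
  have hin : ∀ S : Set DyadicNode, a ∈ S → segSum x S = x a := by
    intro S hS
    unfold segSum
    rw [tsum_eq_single (⟨a, hS⟩ : S)]
    intro b hb
    exact hz _ (fun h => hb (Subtype.ext h.symm))
  have hout : ∀ S : Set DyadicNode, a ∉ S → segSum x S = 0 := by
    intro S hS
    unfold segSum
    convert tsum_zero with b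
    exact hz _ (fun h => hS (h ▸ b.2))
  have hval : pNormSq x {{a}} = (x a) ^ 2 := by
    unfold pNormSq
    rw [tsum_eq_single (⟨{a}, Set.mem_singleton _⟩ : ({{a}} : Set (Set DyadicNode)))]
    · rw [hin _ (Set.mem_singleton a)]
    · rintro ⟨b, hb⟩ hne
      exact absurd (Subtype.ext (Set.mem_singleton_iff.1 hb)) hne
  have hpart : IsPartition {({a} : Set DyadicNode)} := by
    refine ⟨?_, Set.pairwiseDisjoint_singleton _ _⟩
    rintro S rfl
    refine ⟨?_, ?_⟩
    · rintro b rfl c rfl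
      exact Or.inl (List.prefix_refl _)
    · rintro b rfl c rfl d h1 h2
      exact (h2.eq_of_length_le h1.length_le)
  have hub : ∀ r ∈ normSqSet x, r ≤ (x a) ^ 2 := by
    rintro r ⟨Q, hQ, rfl⟩
    unfold pNormSq
    by_cases h : ∃ S ∈ Q, a ∈ S
    · obtain ⟨S, hS, haS⟩ := h
      rw [tsum_eq_single (⟨S, hS⟩ : Q), hin S haS]
      rintro ⟨S', hS'⟩ hne
      rw [hout S' ?_]
      · simp
      · intro haS'
        have := hQ.2 hS' hS (fun h => hne (Subtype.ext h))
        exact Set.disjoint_left.1 this haS' haS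
    · push Not at h
      have : ∀ S : Q, (segSum x S) ^ 2 = 0 := fun S => by rw [hout S (h S S.2)]; simp
      simp only [this, tsum_zero]
      positivity
  refine ⟨{{a}}, hpart, le_antisymm ?_ ?_⟩
  · exact le_csSup ⟨_, hub⟩ ⟨_, hpart, rfl⟩
  · rw [hval]
    exact csSup_le ⟨_, _, hpart, rfl⟩ hub

lemma seg_singleton (a : DyadicNode) : IsSegment {a} := by
  refine ⟨?_, ?_⟩
  · rintro b rfl c rfl
    exact Or.inl (List.prefix_refl _)
  · rintro b rfl c rfl d h1 h2
    exact (h2.eq_of_length_le h1.length_le)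

lemma seg_inter_ran {x : DyadicNode → ℝ} {S : Set DyadicNode} (hS : IsSegment S) :
    IsSegment (S ∩ ran x) :=
  ⟨fun a ha b hb => hS.1 a ha.1 b hb.1, fun a ha b hb c h1 h2 =>
    ⟨hS.2 a ha.1 b hb.1 c h1 h2, ran_complete x a ha.2 b hb.2 c h1 h2⟩⟩

lemma segSum_singleton (v : DyadicNode → ℝ) (a : DyadicNode) : segSum v {a} = v a := by
  simp [segSum]

lemma main_eq {x y z : DyadicNode → ℝ} (hx : HasBddNorm x) (hx0 : x ≠ 0)
    (hsep : Separated x)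
    (hwf : ∀ f : ℕ → DyadicNode, (∀ n, f n ∈ ran x) →
      (∀ n, f n <+: f (n + 1) ∧ f n ≠ f (n + 1)) → False)
    (hy : HasBddNorm y) (hz : HasBddNorm z)
    {l : ℝ} (hl0 : 0 < l) (hl1 : l < 1) (hxyz : x = l • y + (1 - l) • z)
    (hyx : JTnormSq y = JTnormSq x) (hzx : JTnormSq z = JTnormSq x) : y = x := by
  have hfin : ∀ S, IsSegment S → (S ∩ ran x).Finite := fun S hS =>
    chain_finite hwf Set.inter_subset_right (fun a ha b hb => hS.1 a ha.1 b hb.1)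
  -- norming partitions restricted to the range
  have hseg : ∀ P, IsNormingPartition x P → ∀ S ∈ P,
      segSum y (S ∩ ran x) = segSum x (S ∩ ran x) := by
    intro P hP S hS
    refine core hy hz hl0 hl1 hxyz hyx hzx (fun S : P => S.1 ∩ ran x)
      (fun S => seg_inter_ran (hP.1.1 S S.2)) (fun S => hfin _ (hP.1.1 S S.2)) ?_ ?_ ⟨S, hS⟩
    · intro S S' hne
      exact (hP.1.2 S.2 S'.2 (fun h => hne (Subtype.ext h))).mono
        Set.inter_subset_left Set.inter_subset_left
    · simp only [segSum_inter_ran]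
      exact hP.2.ge
  have huncov : ∀ P, IsNormingPartition x P → ∀ a, (∀ S ∈ P, a ∉ S ∩ ran x) → y a = x a := by
    intro P hP a ha
    let A : Option P → Set DyadicNode := fun o => o.elim {a} (fun S => S.1 ∩ ran x)
    have hA : ∀ o, IsSegment (A o) := by
      rintro (_ | S)
      · exact seg_singleton a
      · exact seg_inter_ran (hP.1.1 S S.2)
    have hd : ∀ i j, i ≠ j → Disjoint (A i) (A j) := by
      rintro (_ | S) (_ | S') hne
      · exact absurd rfl hne
      · exact Set.disjoint_singleton_left.2 (ha S' S'.2)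
      · exact Set.disjoint_singleton_right.2 (ha S S.2)
      · exact (hP.1.2 S.2 S'.2 (fun h => hne (by rw [Subtype.ext h]))).mono
          Set.inter_subset_left Set.inter_subset_left
    have := core hy hz hl0 hl1 hxyz hyx hzx A hA ?_ hd ?_ none
    · simpa [A, segSum_singleton] using this
    · rintro (_ | S)
      · exact Set.finite_singleton a
      · exact hfin _ (hP.1.1 S S.2)
    · have h1 := tsum_comp_le_tsum_of_inj (family_summable hx A hA hd)
        (fun _ => sq_nonneg _) (Option.some_injective P)
      refine le_trans ?_ h1
      simp only [Function.comp_def, A, Option.elim, segSum_inter_ran]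
      exact hP.2.ge
  obtain ⟨P₀, hP₀⟩ := exists_norming hx0 hsep
  have hoff : ∀ a, a ∉ ran x → y a = x a := fun a ha =>
    huncov P₀ hP₀ a (fun S _ h => ha h.2)
  -- well-founded induction
  have key : ∀ a ∈ ran x, (∀ b ∈ ran x, a <+: b → a ≠ b → y b = x b) → y a = x a := by
    intro a ha ih
    obtain ⟨P, hP, hPa⟩ : ∃ P, IsNormingPartition x P ∧
        ∀ S ∈ P, a ∈ S → ∀ b ∈ S ∩ ran x, a <+: b := by
      by_cases hpar : a ≠ [] ∧ a.dropLast ∈ ran x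
      · obtain ⟨hne, hp⟩ := hpar
        have hdl : a.dropLast ≠ a := by
          intro h
          have := congrArg List.length h
          have := List.length_pos_iff.2 hne
          simp at *
          omega
        obtain ⟨P, hP, S, hS, S', hS', hSS, h1, h2⟩ := hsep _ hp a ha hdl
        refine ⟨P, hP, ?_⟩
        intro W hW haW b hb
        have hWS : W = S' := by
          by_contra h
          exact Set.disjoint_left.1 (hP.1.2 hW hS' h) haW h2
        subst hWS
        rcases (hP.1.1 W hW).1 a haW b hb.1 with h | h
        · exact h
        · by_cases hab : b = a
          · rw [hab]
          · exfalso
            have hbd : b <+: a.dropLast := by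
              apply List.prefix_of_prefix_length_le h (List.dropLast_prefix a)
              have := h.length_le
              have : b.length ≠ a.length := fun e => hab (h.eq_of_length e)
              simp
              omega
            have := (hP.1.1 W hW).2 b hb.1 a haW _ hbd (List.dropLast_prefix a)
            exact Set.disjoint_left.1 (hP.1.2 hS hS' hSS) h1 this
      · refine ⟨P₀, hP₀, ?_⟩
        intro W hW haW b hb
        rcases (hP₀.1.1 W hW).1 a haW b hb.1 with h | h
        · exact h
        · by_cases hab : b = a
          · rw [hab]
          · exfalso
            have hbd : b <+: a.dropLast := by
              apply List.prefix_of_prefix_length_le h (List.dropLast_prefix a)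
              have := h.length_le
              have : b.length ≠ a.length := fun e => hab (h.eq_of_length e)
              simp
              omega
            apply hpar
            refine ⟨?_, ran_complete x b hb.2 a ha _ hbd (List.dropLast_prefix a)⟩
            rintro rfl
            exact hab (List.prefix_nil.1 h)
    by_cases hcov : ∃ S ∈ P, a ∈ S
    · obtain ⟨S, hS, haS⟩ := hcov
      have h := hseg P hP S hS
      haveI := (hfin S (hP.1.1 S hS)).fintype
      simp only [segSum, tsum_fintype] at h
      have h' : ∑ b : ↑(S ∩ ran x), (y b - x b) = 0 := by
        rw [Finset.sum_sub_distrib, h, sub_self]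
      rw [Finset.sum_eq_single (⟨a, haS, ha⟩ : ↑(S ∩ ran x))] at h'
      · exact sub_eq_zero.1 h'
      · intro b _ hb
        rw [ih b b.2.2 (hPa S hS haS b b.2) (fun e => hb (Subtype.ext e.symm)), sub_self]
      · intro h
        exact absurd (Finset.mem_univ _) h
    · push Not at hcov
      exact huncov P hP a (fun S hS h => hcov S hS h.1)
  funext a
  by_contra hne
  have step : ∀ c : {b // b ∈ ran x ∧ y b ≠ x b},
      ∃ d : {b // b ∈ ran x ∧ y b ≠ x b}, c.1 <+: d.1 ∧ c.1 ≠ d.1 := by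
    rintro ⟨c, hc, hcne⟩
    by_contra hcon
    push Not at hcon
    apply hcne
    apply key c hc
    intro b hb hcb hne
    by_contra hbne
    exact hne (hcon ⟨b, hb, hbne⟩ hcb)
  choose g hg using step
  have haR : a ∈ ran x := by
    by_contra h
    exact hne (hoff a h)
  refine hwf (fun n => (g^[n] ⟨a, haR, hne⟩).1) (fun n => (g^[n] ⟨a, haR, hne⟩).2.1) (fun n => ?_)
  simp only [Function.iterate_succ_apply']
  exact hg _

/-- If `x ∈ JT` is separated and `ran x` is well-founded (contains no
infinite branch, i.e. no infinite strictly increasing chain), then `x` is an extreme point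
of the ball of radius `‖x‖_{JT}`. -/
theorem well_founded_separated_extreme (x : DyadicNode → ℝ) (hx : MemJT x) (hx0 : x ≠ 0)
    (hsep : Separated x)
    (hwf : ∀ f : ℕ → DyadicNode, (∀ n, f n ∈ ran x) →
      (∀ n, f n <+: f (n + 1) ∧ f n ≠ f (n + 1)) → False) :
    IsExtremePoint x := by
  refine ⟨hx0, ?_⟩
  intro y z hy hz l hl0 hl1 hxyz hyx hzx
  have hyx' : JTnormSq y = JTnormSq x :=
    (Real.sqrt_inj (JTnormSq_nonneg y) (JTnormSq_nonneg x)).1 hyx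
  have hzx' : JTnormSq z = JTnormSq x :=
    (Real.sqrt_inj (JTnormSq_nonneg z) (JTnormSq_nonneg x)).1 hzx
  refine ⟨main_eq hx.1 hx0 hsep hwf hy.1 hz.1 hl0 hl1 hxyz hyx' hzx',
    main_eq hx.1 hx0 hsep hwf hz.1 hy.1 (l := 1 - l) (by linarith) (by linarith) ?_ hzx' hyx'⟩
  rw [hxyz, sub_sub_cancel, add_comm]

end JTSpace
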